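/- Let (Γ; ≤₁, …, ≤ₙ) be a homogeneous n-dimensional permutation structure. Let E, F, G be ∅-definable equivalence relations on Γ such that: E is maximal (E is not the trivial relation, and no ∅-definable equivalence relation lies strictly between E and the trivial relation), the join F ⊔ G is the trivial relation, F does not refine E, and G does not refine E. Then the intersection F ⊓ G does not refine E. -/

import Mathlib

/-- An `n`-dimensional permutation structure: a set `Γ` equipped with `n` linear orders. -/
structure PermStruct (n : ℕ) (Γ : Type*) where
  le : Fin n → Γ → Γ → Prop
  total : ∀ i x y, le i x y ∨ le i y x
  antisymm : ∀ i x y, le i x y → le i y x → x = y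
  trans : ∀ i x y z, le i x y → le i y z → le i x z

namespace PermStruct

variable {n : ℕ} {Γ : Type*} (S : PermStruct n Γ)

/-- An automorphism of the permutation structure: a bijection of `Γ` preserving each order. -/
def IsAuto (σ : Γ ≃ Γ) : Prop :=
  ∀ i x y, S.le i x y ↔ S.le i (σ x) (σ y)

/-- Homogeneity: every isomorphism between finite substructures (i.e. every bijection between
finite subsets preserving each order) extends to an automorphism. -/
def Homogeneous : Prop :=
  ∀ (A : Finset Γ) (f : Γ → Γ), Set.InjOn f A →
    (∀ i, ∀ x ∈ A, ∀ y ∈ A, (S.le i x y ↔ S.le i (f x) (f y))) →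
    ∃ σ : Γ ≃ Γ, S.IsAuto σ ∧ ∀ a ∈ A, σ a = f a

/-- A binary relation is ∅-definable iff it is invariant under all automorphisms. -/
def Definable (R : Γ → Γ → Prop) : Prop :=
  ∀ σ : Γ ≃ Γ, S.IsAuto σ → ∀ x y, R x y ↔ R (σ x) (σ y)

/-- `E` is `≤ᵢ`-convex: every `E`-class is an interval with respect to `≤ᵢ`. -/
def Convex (i : Fin n) (E : Γ → Γ → Prop) : Prop :=
  ∀ x y z, S.le i x y → S.le i y z → E x z → E x y

end PermStruct

open Filter

namespace PermStruct

variable {n : ℕ} {Γ : Type*} {S : PermStruct n Γ}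

theorem le_refl' (S : PermStruct n Γ) (i : Fin n) (x : Γ) : S.le i x x :=
  (S.total i x x).elim id id

theorem IsAuto.symm {σ : Γ ≃ Γ} (h : S.IsAuto σ) : S.IsAuto σ.symm := by
  intro i x y
  have := h i (σ.symm x) (σ.symm y)
  simpa using this.symm

/-- Automorphisms act transitively on points. -/
theorem Homogeneous.exists_auto_point (h : S.Homogeneous) (x y : Γ) :
    ∃ σ : Γ ≃ Γ, S.IsAuto σ ∧ σ x = y := by
  obtain ⟨σ, hσ, hx⟩ := h {x} (fun _ => y) (by simp) (by simp [S.le_refl'])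
  exact ⟨σ, hσ, hx x (by simp)⟩

/-- The quantifier-free type of a pair. -/
def pairType (S : PermStruct n Γ) (x y : Γ) : Fin n → Prop := fun i => S.le i x y

theorem pairType_map {σ : Γ ≃ Γ} (hσ : S.IsAuto σ) (x y : Γ) :
    S.pairType (σ x) (σ y) = S.pairType x y :=
  funext fun i => propext (hσ i x y).symm

theorem pairType_trans {x y z : Γ} {r : Fin n → Prop} (hxy : S.pairType x y = r)
    (hyz : S.pairType y z = r) : S.pairType x z = r := by
  funext i
  have h₁ : S.le i x y = r i := congrFun hxy i
  have h₂ : S.le i y z = r i := congrFun hyz i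
  change S.le i x z = r i
  by_cases hr : r i
  · simp only [hr, eq_iff_iff, iff_true] at h₁ h₂ ⊢
    exact S.trans i x y z h₁ h₂
  · simp only [hr, eq_iff_iff, iff_false] at h₁ h₂ ⊢
    exact fun h => h₁ (S.trans i x z y h ((S.total i y z).resolve_left h₂))

theorem le_swap_iff {x y : Γ} (hxy : x ≠ y) (i : Fin n) : S.le i y x ↔ ¬ S.le i x y :=
  ⟨fun h h' => hxy (S.antisymm i x y h' h), fun h => (S.total i x y).resolve_left h⟩

/-- A point can be moved to another one over a finite set realizing the same types. -/
theorem Homogeneous.exists_auto_over (h : S.Homogeneous) (A : Finset Γ) {x y : Γ}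
    (hx : x ∉ A) (hy : y ∉ A) (hxy : ∀ a ∈ A, S.pairType x a = S.pairType y a) :
    ∃ σ : Γ ≃ Γ, S.IsAuto σ ∧ σ x = y ∧ ∀ a ∈ A, σ a = a := by
  classical
  set f : Γ → Γ := Function.update id x y with hf
  have fx : f x = y := by simp [hf]
  have fa : ∀ a ∈ A, f a = a := fun a ha => by
    have : a ≠ x := fun e => hx (e ▸ ha)
    simp [hf, this]
  have ne : ∀ a ∈ A, x ≠ a ∧ y ≠ a := fun a ha => ⟨fun e => hx (e ▸ ha), fun e => hy (e ▸ ha)⟩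
  have key : ∀ a ∈ A, ∀ i, S.le i x a ↔ S.le i y a := fun a ha i =>
    iff_of_eq (congrFun (hxy a ha) i)
  obtain ⟨σ, hσ, hσf⟩ := h (insert x A) f
    (by
      intro u hu v hv huv
      simp only [Finset.coe_insert, Set.mem_insert_iff, Finset.mem_coe] at hu hv
      rcases hu with rfl | hu <;> rcases hv with rfl | hv
      · rfl
      · rw [fx, fa v hv] at huv; exact absurd huv (ne v hv).2
      · rw [fx, fa u hu] at huv; exact absurd huv.symm (ne u hu).2
      · rwa [fa u hu, fa v hv] at huv)
    (by
      intro i u hu v hv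
      rw [Finset.mem_insert] at hu hv
      rcases hu with rfl | hu <;> rcases hv with rfl | hv
      · simp [S.le_refl']
      · rw [fx, fa v hv]; exact key v hv i
      · rw [fx, fa u hu, le_swap_iff (ne u hu).1, le_swap_iff (ne u hu).2, key u hu i]
      · rw [fa u hu, fa v hv])
  refine ⟨σ, hσ, ?_, fun a ha => ?_⟩
  · rw [hσf x (by simp), fx]
  · rw [hσf a (by simp [ha]), fa a ha]

/-- Automorphisms act transitively on the pairs of distinct points of a given type. -/
theorem Homogeneous.exists_auto_pair (h : S.Homogeneous) {x y x' y' : Γ} (hxy : x ≠ y)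
    (hxy' : x' ≠ y') (ht : S.pairType x y = S.pairType x' y') :
    ∃ σ : Γ ≃ Γ, S.IsAuto σ ∧ σ x = x' ∧ σ y = y' := by
  obtain ⟨σ, hσ, hx⟩ := h.exists_auto_point x x'
  have hne : σ y ≠ x' := fun e => hxy (σ.injective (hx.trans e.symm))
  obtain ⟨τ, hτ, hy, hτx⟩ := h.exists_auto_over {x'} (x := σ y) (y := y') (by simpa using hne)
    (by simpa using hxy'.symm) (by
      intro a ha
      obtain rfl := Finset.mem_singleton.1 ha
      have e : S.pairType a (σ y) = S.pairType a y' := by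
        rw [← ht, ← S.pairType_map hσ x y, hx]
      funext i
      have ei := iff_of_eq (congrFun e i)
      exact propext ((le_swap_iff hne.symm i).trans
        ((not_congr ei).trans (le_swap_iff hxy' i).symm)))
  refine ⟨σ.trans τ, fun i u v => (hσ i u v).trans (hτ i _ _), ?_, hy⟩
  simp [hx, hτx x' (by simp)]

/-- Transfer of a relation along two pairs of distinct points of the same type. -/
theorem Definable.of_pairType_eq {R : Γ → Γ → Prop} (hR : S.Definable R) (h : S.Homogeneous)
    {x y x' y' : Γ} (hxy : x ≠ y) (hxy' : x' ≠ y') (ht : S.pairType x y = S.pairType x' y')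
    (hr : R x y) : R x' y' := by
  obtain ⟨σ, hσ, rfl, rfl⟩ := h.exists_auto_pair hxy hxy' ht
  exact (hR σ hσ x y).1 hr

/-- To prove that a relation is definable, one implication suffices. -/
theorem definable_of_imp {R : Γ → Γ → Prop}
    (hR : ∀ σ : Γ ≃ Γ, S.IsAuto σ → ∀ x y, R x y → R (σ x) (σ y)) : S.Definable R :=
  fun σ hσ x y => ⟨hR σ hσ x y, fun h => by simpa using hR σ.symm hσ.symm _ _ h⟩

/-- If `R` is definable, so is inclusion of `R`-neighbourhoods. -/
theorem Definable.subset {R : Γ → Γ → Prop} (hR : S.Definable R) :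
    S.Definable fun x y => ∀ u, R x u → R y u :=
  definable_of_imp fun σ hσ x y h u hu => by
    have h₁ := (hR σ hσ x (σ.symm u)).2 (by simpa using hu)
    simpa using (hR σ hσ y (σ.symm u)).1 (h _ h₁)

/-- In a quotient by a maximal relation `E` ordered by an invariant order, the classes of a
definable equivalence relation not refining `E` are cofinal. -/
theorem exists_cofinal (hhom : S.Homogeneous) {E F P : Γ → Γ → Prop}
    (hFdef : S.Definable F) (hFequiv : Equivalence F)
    (hEmax : ∀ H : Γ → Γ → Prop, S.Definable H → Equivalence H →
      (∀ x y, E x y → H x y) → (¬ ∀ x y, H x y) → ∀ x y, H x y → E x y)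
    (hFnr : ¬ ∀ x y, F x y → E x y)
    (hP : S.Definable P) (hPtotal : ∀ x y, P x y ∨ P y x)
    (hPtrans : ∀ x y z, P x y → P y z → P x z) (hEP : ∀ x y, E x y ↔ P x y ∧ P y x) (x u : Γ) :
    ∃ y, F x y ∧ P u y := by
  by_contra hcon
  let L : Γ → Γ → Prop := fun x u => ∃ y, F x y ∧ P u y
  have hL : S.Definable L := definable_of_imp fun σ hσ x u ⟨y, hy, hu⟩ =>
    ⟨σ y, (hFdef σ hσ _ _).1 hy, (hP σ hσ _ _).1 hu⟩
  have hPrefl : ∀ x, P x x := fun x => (hPtotal x x).elim id id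
  have hLrefl : ∀ x, L x x := fun x => ⟨x, hFequiv.refl x, hPrefl x⟩
  have hLF : ∀ x y, F x y → ∀ u, L x u → L y u := fun x y hxy u ⟨v, hv, hu⟩ =>
    ⟨v, hFequiv.trans (hFequiv.symm hxy) hv, hu⟩
  have hLlow : ∀ x u v, P u v → L x v → L x u := fun x u v huv ⟨y, hy, hv⟩ =>
    ⟨y, hy, hPtrans _ _ _ huv hv⟩
  -- the set of points below the `F`-class is not constant on `E`-classes
  have hvary : ∃ x y, E x y ∧ ¬ ∀ u, L y u → L x u := by
    by_contra! hno
    refine hFnr fun a b hab => hEmax (fun x y => (∀ u, L x u → L y u) ∧ ∀ u, L y u → L x u)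
      ?_ ⟨fun _ => ⟨fun _ h => h, fun _ h => h⟩, fun h => ⟨h.2, h.1⟩, fun h h' =>
        ⟨fun u hu => h'.1 u (h.1 u hu), fun u hu => h.2 u (h'.2 u hu)⟩⟩ ?_ ?_ a b
        ⟨hLF a b hab, hLF b a (hFequiv.symm hab)⟩
    · exact fun σ hσ x y => and_congr (hL.subset σ hσ x y) (hL.subset σ hσ y x)
    · exact fun x y hxy => ⟨hno y x ((hEP y x).2 ((hEP x y).1 hxy).symm), hno x y hxy⟩
    · exact fun hall => hcon ((hall x u).2 u (hLrefl u))
  have hvary' : ∀ x, ∃ y, E x y ∧ ¬ ∀ u, L y u → L x u := by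
    obtain ⟨a, b, hab, hn⟩ := hvary
    intro x
    obtain ⟨σ, hσ, rfl⟩ := hhom.exists_auto_point a x
    refine ⟨σ b, ?_, fun h => hn ((hL.subset σ hσ b a).2 h)⟩
    rw [hEP] at hab ⊢
    exact ⟨(hP σ hσ _ _).1 hab.1, (hP σ hσ _ _).1 hab.2⟩
  -- every point has a strictly larger `F`-equivalent point
  obtain ⟨s, hxs, hs⟩ : ∃ s, F x s ∧ ¬ P s x := by
    push Not at hFnr
    obtain ⟨a, b, hab, hn⟩ := hFnr
    have hn' : ¬ P b a ∨ ¬ P a b := by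
      rw [hEP] at hn; tauto
    rcases hn' with hn' | hn'
    · obtain ⟨σ, hσ, rfl⟩ := hhom.exists_auto_point a x
      exact ⟨σ b, (hFdef σ hσ _ _).1 hab, fun h => hn' ((hP σ hσ _ _).2 h)⟩
    · obtain ⟨σ, hσ, rfl⟩ := hhom.exists_auto_point b x
      exact ⟨σ a, (hFdef σ hσ _ _).1 (hFequiv.symm hab), fun h => hn' ((hP σ hσ _ _).2 h)⟩
  let Ov : Γ → Γ → Prop := fun x y => ¬ P y x ∧ L x y ∧ ¬ ∀ u, L y u → L x u
  have hPne : ∀ {x y}, ¬ P y x → x ≠ y := fun {x y} h e => h (e ▸ hPrefl x)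
  have hbound : ∀ r : Fin n → Prop, ∃ v, F x v ∧
      ∀ y, Ov x y → S.pairType x y = r → P v y → False := by
    intro r
    by_cases hr : ∃ a b, Ov a b ∧ S.pairType a b = r
    · obtain ⟨a, b, ⟨hab, hLab, hn⟩, hr⟩ := hr
      push Not at hn
      obtain ⟨w, ⟨v, hbv, hwv⟩, haw⟩ := hn
      have hav : ¬ L a v := fun h => haw (hLlow a w v hwv h)
      obtain ⟨σ, hσ, rfl⟩ := hhom.exists_auto_point b x
      refine ⟨σ v, (hFdef σ hσ _ _).1 hbv, fun y hy hty hvy => ?_⟩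
      obtain ⟨y, rfl⟩ := σ.surjective y
      have hvy := (hP σ hσ _ _).2 hvy
      have hby : ¬ P y b := fun h => hy.1 ((hP σ hσ _ _).1 h)
      have hay : ¬ P y a := fun h => hby (hPtrans _ _ _ h
        ((hPtotal a b).resolve_right hab))
      rw [pairType_map hσ] at hty
      have hLay : L a y := hL.of_pairType_eq hhom (hPne hab) (hPne hay)
        (hr.trans (pairType_trans hr hty).symm) hLab
      exact hav (hLlow a v y hvy hLay)
    · push Not at hr
      exact ⟨x, hFequiv.refl x, fun y hy ht _ => hr x y hy ht⟩
  choose v hv hvb using hbound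
  obtain ⟨t, hxt, ht⟩ : ∃ t, F x t ∧ ∀ r : Option (Fin n → Prop), P (r.elim s v) t := by
    let g : Option (Fin n → Prop) → {y // F x y} := fun r =>
      ⟨r.elim s v, by cases r <;> simp [hxs, hv]⟩
    let _ : Preorder {y // F x y} :=
      { le := fun a b => P a b, le_refl := fun a => hPrefl a
        le_trans := fun a b c => hPtrans a b c }
    have : IsDirectedOrder {y // F x y} := ⟨fun a b => (hPtotal a b).elim
      (fun h => ⟨b, h, hPrefl b⟩) fun h => ⟨a, hPrefl a, h⟩⟩
    have : Nonempty {y // F x y} := ⟨⟨s, hxs⟩⟩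
    obtain ⟨t, ht⟩ := Finite.exists_le g
    exact ⟨t, t.2, ht⟩
  obtain ⟨y, hty, hny⟩ := hvary' t
  have hty := (hEP t y).1 hty
  refine hvb (S.pairType x y) y ⟨?_, ⟨t, hxt, hty.2⟩, fun h => hny fun u hu => ?_⟩ rfl
    (hPtrans _ _ _ (ht (some _)) hty.1)
  · exact fun h => hs (hPtrans _ _ _ (hPtrans _ _ _ (ht none) hty.1) h)
  · exact hLF x t hxt u (h u hu)

/-- An invariant function on filters refining each filter so that every set of an invariant
chain is decided. -/
theorem exists_refine_chain (S : PermStruct n Γ) (W : Set (Set Γ))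
    (hchain : ∀ s ∈ W, ∀ t ∈ W, s ⊆ t ∨ t ⊆ s)
    (hinv : ∀ σ : Γ ≃ Γ, S.IsAuto σ → ∀ s ∈ W, σ ⁻¹' s ∈ W) :
    ∃ Φ : Filter Γ → Filter Γ, (∀ l, Φ l ≤ l) ∧ (∀ l, l.NeBot → (Φ l).NeBot) ∧
      (∀ l, ∀ s ∈ W, s ∈ Φ l ∨ sᶜ ∈ Φ l) ∧
      ∀ σ : Γ ≃ Γ, S.IsAuto σ → ∀ l, map σ (Φ l) = Φ (map σ l) := by
  let Φ : Filter Γ → Filter Γ := fun l => l ⊓ ⨅ s : {s // s ∈ W ∧ ∃ᶠ y in l, y ∈ s}, 𝓟 s.1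
  have hle : ∀ σ : Γ ≃ Γ, S.IsAuto σ → ∀ l, map σ (Φ l) ≤ Φ (map σ l) := by
    intro σ hσ l
    refine le_inf (map_mono inf_le_left) (le_iInf fun ⟨s, hs, hf⟩ => ?_)
    rw [le_principal_iff, mem_map]
    have hmem : σ ⁻¹' s ∈ W ∧ ∃ᶠ y in l, y ∈ σ ⁻¹' s := ⟨hinv σ hσ s hs, frequently_map.1 hf⟩
    exact (inf_le_right.trans (iInf_le (fun s : {s // s ∈ W ∧ ∃ᶠ y in l, y ∈ s} => 𝓟 s.1)
      ⟨_, hmem⟩)) (mem_principal_self _)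
  refine ⟨Φ, fun l => inf_le_left, fun l hl => ?_, fun l s hs => ?_, fun σ hσ l =>
    le_antisymm (hle σ hσ l) ?_⟩
  · rcases isEmpty_or_nonempty {s // s ∈ W ∧ ∃ᶠ y in l, y ∈ s} with he | he
    · simpa [Φ, iInf_of_empty] using hl
    · have hd : Directed (· ≥ ·) fun s : {s // s ∈ W ∧ ∃ᶠ y in l, y ∈ s} => 𝓟 s.1 := by
        rintro ⟨s, hs⟩ ⟨t, ht⟩
        rcases hchain s hs.1 t ht.1 with h | h
        · exact ⟨⟨s, hs⟩, le_rfl, principal_mono.2 h⟩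
        · exact ⟨⟨t, ht⟩, principal_mono.2 h, le_rfl⟩
      rw [inf_neBot_iff]
      intro A hA B hB
      obtain ⟨⟨s, hs⟩, hsB⟩ := (mem_iInf_of_directed hd B).1 hB
      obtain ⟨y, hy, hyA⟩ := (hs.2.and_eventually hA).exists
      exact ⟨y, hyA, hsB hy⟩
  · by_cases hf : ∃ᶠ y in l, y ∈ s
    · exact Or.inl ((inf_le_right.trans (iInf_le
        (fun s : {s // s ∈ W ∧ ∃ᶠ y in l, y ∈ s} => 𝓟 s.1) ⟨s, hs, hf⟩)) (mem_principal_self _))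
    · exact Or.inr ((inf_le_left : Φ l ≤ l) (not_frequently.1 hf))
  · have h := map_mono (m := σ) (hle σ.symm hσ.symm (map σ l))
    simpa [map_map] using h

/-- Simultaneous version of `exists_refine_chain` for finitely many invariant chains. -/
theorem exists_refine (S : PermStruct n Γ) {ι : Type*} [Finite ι] (W : ι → Set (Set Γ))
    (hchain : ∀ i, ∀ s ∈ W i, ∀ t ∈ W i, s ⊆ t ∨ t ⊆ s)
    (hinv : ∀ i, ∀ σ : Γ ≃ Γ, S.IsAuto σ → ∀ s ∈ W i, σ ⁻¹' s ∈ W i) :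
    ∃ Φ : Filter Γ → Filter Γ, (∀ l, Φ l ≤ l) ∧ (∀ l, l.NeBot → (Φ l).NeBot) ∧
      (∀ l, ∀ i, ∀ s ∈ W i, s ∈ Φ l ∨ sᶜ ∈ Φ l) ∧
      ∀ σ : Γ ≃ Γ, S.IsAuto σ → ∀ l, map σ (Φ l) = Φ (map σ l) := by
  classical
  cases nonempty_fintype ι
  suffices h : ∀ I : Finset ι, ∃ Φ : Filter Γ → Filter Γ, (∀ l, Φ l ≤ l) ∧
      (∀ l, l.NeBot → (Φ l).NeBot) ∧ (∀ l, ∀ i ∈ I, ∀ s ∈ W i, s ∈ Φ l ∨ sᶜ ∈ Φ l) ∧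
      ∀ σ : Γ ≃ Γ, S.IsAuto σ → ∀ l, map σ (Φ l) = Φ (map σ l) by
    simpa using h Finset.univ
  intro I
  induction I using Finset.induction_on with
  | empty => exact ⟨id, fun _ => le_rfl, fun _ h => h, by simp, fun _ _ _ => rfl⟩
  | insert i I _ ih =>
    obtain ⟨Φ, h₁, h₂, h₃, h₄⟩ := ih
    obtain ⟨Ψ, k₁, k₂, k₃, k₄⟩ := S.exists_refine_chain (W i) (hchain i) (hinv i)
    refine ⟨fun l => Ψ (Φ l), fun l => (k₁ _).trans (h₁ l), fun l hl => k₂ _ (h₂ l hl),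
      fun l j hj s hs => ?_, fun σ hσ l => by rw [k₄ σ hσ, h₄ σ hσ]⟩
    rcases Finset.mem_insert.1 hj with rfl | hj
    · exact k₃ _ s hs
    · exact (h₃ l j hj s hs).imp (fun h => k₁ _ h) fun h => k₁ _ h

/-- A class of an equivalence relation `F` not refining `E` meets infinitely many `E`-classes;
here expressed as non-triviality of the filter of complements of `E`-classes on an `F`-class. -/
theorem neBot_compl_classes (hn : n ≠ 0) (hhom : S.Homogeneous) {E F : Γ → Γ → Prop}
    (hEdef : S.Definable E) (hEequiv : Equivalence E)
    (hFdef : S.Definable F) (hFequiv : Equivalence F)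
    (hFnr : ¬ ∀ x y, F x y → E x y) (z : Γ) :
    (𝓟 {a | F z a} ⊓ ⨅ u, 𝓟 {a | ¬ E u a}).NeBot := by
  push Not at hFnr
  obtain ⟨x, y, hxy, hE⟩ := hFnr
  have hne : x ≠ y := fun e => hE (e ▸ hEequiv.refl x)
  let Q : Γ → Γ → Prop := fun a b => a ≠ b ∧ S.pairType a b = S.pairType x y
  have hQF : ∀ {a b}, Q a b → F a b := fun h =>
    hFdef.of_pairType_eq hhom hne h.1 h.2.symm hxy
  have hQE : ∀ {a b}, Q a b → ¬ E a b := fun h hE' =>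
    hE (hEdef.of_pairType_eq hhom h.1 hne h.2 hE')
  have hQtrans : ∀ {a b c}, Q a b → Q b c → Q a c := by
    intro a b c hab hbc
    refine ⟨?_, pairType_trans hab.2 hbc.2⟩
    rintro rfl
    have i : Fin n := ⟨0, Nat.pos_of_ne_zero hn⟩
    have h : S.le i a b ↔ S.le i b a := iff_of_eq (congrFun (hab.2.trans hbc.2.symm) i)
    rw [le_swap_iff hab.1] at h
    tauto
  obtain ⟨w, hzw⟩ : ∃ w, Q z w := by
    obtain ⟨σ, hσ, rfl⟩ := hhom.exists_auto_point x z
    exact ⟨σ y, σ.injective.ne hne, pairType_map hσ x y⟩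
  obtain ⟨σ, hσ, hσz⟩ := hhom.exists_auto_point z w
  let f : ℕ → Γ := fun k => σ^[k] z
  have hf : ∀ k, Q (f k) (f (k + 1)) := by
    intro k
    induction k with
    | zero => simpa [f, hσz] using hzw
    | succ k ih =>
      have e : ∀ m, f (m + 1) = σ (f m) := fun m => Function.iterate_succ_apply' σ m z
      rw [e k, e (k + 1), e k]
      rw [e k] at ih
      exact ⟨σ.injective.ne ih.1, (pairType_map hσ _ _).trans ih.2⟩
  have hlt : ∀ {j k}, j < k → Q (f j) (f k) := fun {j k} h => by
    have : IsTrans Γ Q := ⟨fun _ _ _ => hQtrans⟩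
    exact Nat.rel_of_forall_rel_succ_of_lt Q hf h
  have ht : Tendsto f atTop (𝓟 {a | F z a} ⊓ ⨅ u, 𝓟 {a | ¬ E u a}) := by
    refine tendsto_inf.2 ⟨tendsto_principal.2 (Eventually.of_forall fun k => ?_),
      tendsto_iInf.2 fun u => tendsto_principal.2 ?_⟩
    · rcases Nat.eq_zero_or_pos k with rfl | hk
      · exact hFequiv.refl z
      · exact hQF (hlt hk)
    · by_cases h : ∃ j, E u (f j)
      · obtain ⟨j, hj⟩ := h
        filter_upwards [eventually_gt_atTop j] with k hk hu
        exact hQE (hlt hk) (hEequiv.trans (hEequiv.symm hj) hu)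
      · push Not at h
        exact Eventually.of_forall h
  exact ht.neBot

theorem map_principal_rel {R : Γ → Γ → Prop} (hR : S.Definable R) {σ : Γ ≃ Γ}
    (hσ : S.IsAuto σ) (x : Γ) : map σ (𝓟 {a | R x a}) = 𝓟 {a | R (σ x) a} := by
  rw [map_principal]
  congr 1
  ext a
  constructor
  · rintro ⟨b, hb, rfl⟩
    exact (hR σ hσ _ _).1 hb
  · exact fun h => ⟨σ.symm a, (hR σ hσ _ _).2 (by simpa using h), by simp⟩

theorem map_iInf_compl {E : Γ → Γ → Prop} (hE : S.Definable E) {σ : Γ ≃ Γ}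
    (hσ : S.IsAuto σ) : map σ (⨅ u, 𝓟 {a | ¬ E u a}) = ⨅ u, 𝓟 {a | ¬ E u a} := by
  have hn : S.Definable fun x y => ¬ E x y := fun σ hσ x y => not_congr (hE σ hσ x y)
  rw [← comap_equiv_symm, comap_iInf]
  simp only [comap_equiv_symm]
  rw [← σ.surjective.iInf_comp fun u => 𝓟 {a | ¬ E u a}]
  exact iInf_congr fun u => map_principal_rel hn hσ u

/-- Far out in a class of `F` there are points which do not separate two given `E`-classes with
respect to any cut-valued invariant `U` of `E`-classes. -/
theorem exists_not_separating (hn : n ≠ 0) (hhom : S.Homogeneous) {E F : Γ → Γ → Prop}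
    (hEdef : S.Definable E) (hEequiv : Equivalence E)
    (hFdef : S.Definable F) (hFequiv : Equivalence F)
    (hEmax : ∀ H : Γ → Γ → Prop, S.Definable H → Equivalence H →
      (∀ x y, E x y → H x y) → (¬ ∀ x y, H x y) → ∀ x y, H x y → E x y)
    (hFnr : ¬ ∀ x y, F x y → E x y) (U : Fin n → Γ → Γ → Prop) (hU : ∀ i, S.Definable (U i))
    (hUE : ∀ i x y, E x y → ∀ a, U i x a → U i y a)
    (hUtotal : ∀ i x y, (∀ a, U i x a → U i y a) ∨ ∀ a, U i y a → U i x a) (z w : Γ) :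
    ∃ a, F z a ∧ ¬ E z a ∧ ¬ E w a ∧ ∀ i, U i z a ↔ U i w a := by
  obtain ⟨Φ, hΦle, hΦbot, hΦdec, hΦmap⟩ := S.exists_refine
    (fun i => Set.range fun u => {a | U i u a})
    (by rintro i _ ⟨x, rfl⟩ _ ⟨y, rfl⟩; exact hUtotal i x y)
    (by
      rintro i σ hσ _ ⟨x, rfl⟩
      refine ⟨σ.symm x, ?_⟩
      ext a
      simpa using hU i σ hσ (σ.symm x) a)
  let f : Γ → Filter Γ := fun x => Φ (𝓟 {a | F x a} ⊓ ⨅ u, 𝓟 {a | ¬ E u a})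
  have hfmap : ∀ σ : Γ ≃ Γ, S.IsAuto σ → ∀ x, map σ (f x) = f (σ x) := by
    intro σ hσ x
    simp only [f]
    rw [hΦmap σ hσ, map_inf σ.injective, map_principal_rel hFdef hσ, map_iInf_compl hEdef hσ]
  have hfF : ∀ x y, F x y → f x = f y := by
    intro x y h
    have : {a | F x a} = {a | F y a} := by
      ext a
      exact ⟨hFequiv.trans (hFequiv.symm h), hFequiv.trans h⟩
    simp only [f, this]
  have : (f z).NeBot := hΦbot _
    (neBot_compl_classes hn hhom hEdef hEequiv hFdef hFequiv hFnr z)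
  have hfz : f z ≤ 𝓟 {a | F z a} ⊓ ⨅ u, 𝓟 {a | ¬ E u a} := hΦle _
  have h₁ : ∀ᶠ a in f z, F z a := (hfz.trans inf_le_left) (mem_principal_self _)
  have h₂ : ∀ u, ∀ᶠ a in f z, ¬ E u a := fun u =>
    (hfz.trans (inf_le_right.trans (iInf_le _ u))) (mem_principal_self _)
  have h₃ : ∀ i, ∀ᶠ a in f z, U i z a ↔ U i w a := by
    intro i
    by_cases hconst : ∀ x y, ∀ a, U i x a → U i y a
    · exact Eventually.of_forall fun a => ⟨hconst z w a, hconst w z a⟩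
    have hker : ∀ x y, ((∀ a, U i x a → U i y a) ∧ ∀ a, U i y a → U i x a) → E x y := by
      refine hEmax _ (fun σ hσ x y => and_congr ((hU i).subset σ hσ x y) ((hU i).subset σ hσ y x))
        ⟨fun _ => ⟨fun _ h => h, fun _ h => h⟩, fun h => ⟨h.2, h.1⟩, fun h h' =>
        ⟨fun u hu => h'.1 u (h.1 u hu), fun u hu => h.2 u (h'.2 u hu)⟩⟩
        (fun x y h => ⟨hUE i x y h, hUE i y x (hEequiv.symm h)⟩)
        fun h => hconst fun x y => (h x y).1
    have hkeriff : ∀ x y, E x y ↔ (∀ a, U i x a → U i y a) ∧ ∀ a, U i y a → U i x a :=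
      fun x y => ⟨fun h => ⟨hUE i x y h, hUE i y x (hEequiv.symm h)⟩, hker x y⟩
    have hup := exists_cofinal hhom (E := E) (P := fun x y => ∀ a, U i x a → U i y a) hFdef hFequiv
      hEmax hFnr (hU i).subset (hUtotal i) (fun x y z h h' a ha => h' a (h a ha)) hkeriff z
    have hdown := exists_cofinal hhom (E := E) (P := fun x y => ∀ a, U i y a → U i x a) hFdef
      hFequiv hEmax hFnr (fun σ hσ x y => (hU i).subset σ hσ y x) (fun x y => hUtotal i y x)
      (fun x y z h h' a ha => h a (h' a ha)) (fun x y => (hkeriff x y).trans and_comm) z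
    let V : Γ → Γ → Prop := fun x u => ∀ᶠ a in f x, U i u a
    have hV : S.Definable V := fun σ hσ x u => by
      simp only [V]
      rw [← hfmap σ hσ, eventually_map]
      simp only [← hU i σ hσ u]
    have hmove : ∀ {x y}, F x y → (V x x ↔ V x y) := by
      intro x y hxy
      obtain ⟨σ, hσ, rfl⟩ := hhom.exists_auto_point x y
      refine (hV σ hσ x x).trans ?_
      simp only [V, hfF _ _ hxy]
    have hiff : ∀ u, V z z ↔ V z u := by
      intro u
      constructor
      · intro h
        obtain ⟨y, hy, hyu⟩ := hdown u
        exact ((hmove hy).1 h).mono fun a ha => hyu a ha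
      · intro h
        obtain ⟨y, hy, huy⟩ := hup u
        exact (hmove hy).2 (h.mono fun a ha => huy a ha)
    have hdec : ∀ u, ¬ V z u → ∀ᶠ a in f z, ¬ U i u a := fun u hu =>
      (hΦdec _ i {a | U i u a} ⟨u, rfl⟩).resolve_left hu
    by_cases hz : V z z
    · filter_upwards [hz, (hiff w).1 hz] with a h h'
      simp [h, h']
    · filter_upwards [hdec z hz, hdec w fun h => hz ((hiff w).2 h)] with a h h'
      simp [h, h']
  obtain ⟨a, ha₁, ha₂, ha₃, ha₄⟩ := (h₁.and ((h₂ z).and ((h₂ w).and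
    (eventually_all.2 h₃)))).exists
  exact ⟨a, ha₁, ha₂, ha₃, ha₄⟩

/-- Equivariant limit cuts of the classes of a definable equivalence relation `E`: the set `U i x`
is the upper part of a `≤ᵢ`-cut, and points of the class of `x` realize all these cuts over any
finite set. -/
theorem exists_limit_cuts (S : PermStruct n Γ) {E : Γ → Γ → Prop} (hEdef : S.Definable E)
    (hEequiv : Equivalence E) :
    ∃ U : Fin n → Γ → Γ → Prop, (∀ i, S.Definable (U i)) ∧
      (∀ i x y, E x y → ∀ a, U i x a → U i y a) ∧
      (∀ i x y, (∀ a, U i x a → U i y a) ∨ ∀ a, U i y a → U i x a) ∧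
      ∀ (x : Γ) (A : Finset Γ), ∃ y, E x y ∧ ∀ a ∈ A, ∀ i, S.le i y a ↔ U i x a := by
  obtain ⟨Φ, hΦle, hΦbot, hΦdec, hΦmap⟩ := S.exists_refine
    (fun i => Set.range fun a => {y | S.le i y a})
    (by
      rintro i _ ⟨x, rfl⟩ _ ⟨y, rfl⟩
      exact (S.total i x y).imp (fun h a ha => S.trans i _ _ _ ha h)
        fun h a ha => S.trans i _ _ _ ha h)
    (by
      rintro i σ hσ _ ⟨x, rfl⟩
      refine ⟨σ.symm x, ?_⟩
      ext a
      simpa using hσ i a (σ.symm x))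
  let f : Γ → Filter Γ := fun x => Φ (𝓟 {a | E x a})
  refine ⟨fun i x a => ∀ᶠ y in f x, S.le i y a, fun i σ hσ x a => ?_, fun i x y h a => ?_,
    fun i x y => ?_, fun x A => ?_⟩
  · have : map σ (f x) = f (σ x) := by
      simp only [f]
      rw [hΦmap σ hσ, map_principal_rel hEdef hσ]
    simp only [← this, eventually_map, ← hσ i _ a]
  · have : {a | E x a} = {a | E y a} := by
      ext a
      exact ⟨hEequiv.trans (hEequiv.symm h), hEequiv.trans h⟩
    simp only [f, this]
    exact id
  · by_contra h
    simp only [not_or, not_forall] at h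
    obtain ⟨⟨a, ha, hna⟩, b, hb, hnb⟩ := h
    rcases S.total i a b with hab | hab
    · exact hnb (ha.mono fun y hy => S.trans i _ _ _ hy hab)
    · exact hna (hb.mono fun y hy => S.trans i _ _ _ hy hab)
  · have : (f x).NeBot := hΦbot _ (principal_neBot_iff.2 ⟨x, hEequiv.refl x⟩)
    have h₁ : ∀ᶠ y in f x, E x y := hΦle _ (mem_principal_self _)
    have h₂ : ∀ᶠ y in f x, ∀ a ∈ A, ∀ i, S.le i y a ↔ ∀ᶠ y in f x, S.le i y a := by
      refine (Filter.eventually_all_finset A).2 fun a _ => eventually_all.2 fun i => ?_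
      rcases hΦdec (𝓟 {a | E x a}) i {y | S.le i y a} ⟨a, rfl⟩ with h | h
      · have h' : ∀ᶠ y in f x, S.le i y a := h
        exact h'.mono fun y hy => by simp [hy, h']
      · have h' : ∀ᶠ y in f x, ¬ S.le i y a := h
        have hnot : ¬ ∀ᶠ y in f x, S.le i y a := fun h'' => by
          obtain ⟨y, hy, hy'⟩ := (h'.and h'').exists
          exact hy hy'
        exact h'.mono fun y hy => by simp [hy, hnot]
    exact (h₁.and h₂).exists

end PermStruct

/-- In a homogeneous `n`-dimensional permutation structure, if `E` is a maximal ∅-definable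
equivalence relation, `F ⊔ G` is the trivial relation, and neither `F` nor `G` refines `E`,
then `F ⊓ G` does not refine `E`. -/
theorem meet_does_not_refine_maximal
    {n : ℕ} {Γ : Type*} [Countable Γ] [Infinite Γ] (S : PermStruct n Γ)
    (hhom : S.Homogeneous)
    (E F G : Γ → Γ → Prop)
    (hEdef : S.Definable E) (hEequiv : Equivalence E)
    (hFdef : S.Definable F) (hFequiv : Equivalence F)
    (hGdef : S.Definable G) (hGequiv : Equivalence G)
    (hEproper : ¬ ∀ x y, E x y)
    (hEmax : ∀ H : Γ → Γ → Prop, S.Definable H → Equivalence H →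
      (∀ x y, E x y → H x y) → (¬ ∀ x y, H x y) → ∀ x y, H x y → E x y)
    (hjoin : ∀ x y : Γ, Relation.TransGen (fun u v => F u v ∨ G u v) x y)
    (hFnr : ¬ ∀ x y, F x y → E x y) (hGnr : ¬ ∀ x y, G x y → E x y) :
    ¬ ∀ x y, F x y ∧ G x y → E x y := by
  intro hFG
  rcases eq_or_ne n 0 with rfl | hn
  · push Not at hFnr hGnr
    obtain ⟨x, y, hF, hxy⟩ := hFnr
    obtain ⟨x', y', hG, hxy'⟩ := hGnr
    exact hxy (hFG x y ⟨hF, hGdef.of_pairType_eq hhom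
      (by rintro rfl; exact hxy' (hEequiv.refl _)) (by rintro rfl; exact hxy (hEequiv.refl _))
      (Subsingleton.elim _ _) hG⟩)
  push Not at hEproper
  obtain ⟨z, w, hzw⟩ := hEproper
  obtain ⟨U, hU, hUE, hUtotal, hUlim⟩ := S.exists_limit_cuts hEdef hEequiv
  obtain ⟨a, hza, hEza, hEwa, haU⟩ := PermStruct.exists_not_separating hn hhom hEdef hEequiv
    hFdef hFequiv hEmax hFnr U hU hUE hUtotal z w
  obtain ⟨b, hzb, hEzb, hEwb, hbU⟩ := PermStruct.exists_not_separating hn hhom hEdef hEequiv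
    hGdef hGequiv hEmax hGnr U hU hUE hUtotal z w
  classical
  obtain ⟨x, hzx, hx⟩ := hUlim z {a, b}
  obtain ⟨y, hwy, hy⟩ := hUlim w {a, b}
  have hnot : ∀ {u v}, E u v → ¬ E u a → ¬ E u b → v ∉ ({a, b} : Finset Γ) := by
    intro u v huv hua hub hv
    simp only [Finset.mem_insert, Finset.mem_singleton] at hv
    rcases hv with rfl | rfl
    · exact hua huv
    · exact hub huv
  obtain ⟨σ, hσ, hσx, hσA⟩ := hhom.exists_auto_over {a, b} (hnot hzx hEza hEzb)
    (hnot hwy hEwa hEwb) (by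
      intro c hc
      funext i
      refine propext ((hx c hc i).trans (Iff.trans ?_ (hy c hc i).symm))
      simp only [Finset.mem_insert, Finset.mem_singleton] at hc
      rcases hc with rfl | rfl
      · exact haU i
      · exact hbU i)
  have hF : F z (σ z) := by
    have h := (hFdef σ hσ z a).1 hza
    rw [hσA a (by simp)] at h
    exact hFequiv.trans hza (hFequiv.symm h)
  have hG : G z (σ z) := by
    have h := (hGdef σ hσ z b).1 hzb
    rw [hσA b (by simp)] at h
    exact hGequiv.trans hzb (hGequiv.symm h)
  have hE : E (σ z) y := hσx ▸ (hEdef σ hσ z x).1 hzx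
  exact hzw (hEequiv.trans (hEequiv.trans (hFG z (σ z) ⟨hF, hG⟩) hE) (hEequiv.symm hwy))
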